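/- Let μ, μ₁, μ₂ be probability distributions on ℝ with μ = μ₁ * μ₂, and suppose μ is quasi-infinitely divisible with support contained in ℤ. Then μ₁ and μ₂ are quasi-infinitely divisible. -/

import Mathlib

open MeasureTheory Complex Filter

noncomputable section

/-- Characteristic function of a measure on ℝ. -/
def charFn (μ : Measure ℝ) (z : ℝ) : ℂ := ∫ x, Complex.exp (Complex.I * z * x) ∂μ

/-- A representation function: bounded, Borel measurable, with (c x - x)/x² → 0 as x → 0. -/
def IsRepFn (c : ℝ → ℝ) : Prop :=
  Measurable c ∧ (∃ M : ℝ, ∀ x, |c x| ≤ M) ∧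
    Tendsto (fun x => (c x - x) / x ^ 2) (nhdsWithin 0 {(0:ℝ)}ᶜ) (nhds 0)

/-- The kernel g_c(x,z). -/
def gKer (c : ℝ → ℝ) (x z : ℝ) : ℂ :=
  if x = 0 then -(z:ℂ)^2 / 2
  else (Complex.exp (Complex.I * z * x) - 1 - Complex.I * z * c x) / ((min 1 (x^2) : ℝ) : ℂ)

/-- Quasi-infinitely divisible w.r.t. c: the characteristic function has a
Lévy–Khintchine type representation with a finite signed measure ζ = ζp - ζm
(given by its Jordan decomposition). -/
def IsQID (c : ℝ → ℝ) (μ : Measure ℝ) : Prop :=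
  ∃ γ : ℝ, ∃ ζp ζm : Measure ℝ, IsFiniteMeasure ζp ∧ IsFiniteMeasure ζm ∧
    Measure.MutuallySingular ζp ζm ∧
    ∀ z : ℝ, charFn μ z =
      Complex.exp (Complex.I * γ * z + (∫ x, gKer c x z ∂ζp) - ∫ x, gKer c x z ∂ζm)

/-- Infinitely divisible w.r.t. c: as above with a (positive) finite measure ζ. -/
def IsID (c : ℝ → ℝ) (μ : Measure ℝ) : Prop :=
  ∃ γ : ℝ, ∃ ζ : Measure ℝ, IsFiniteMeasure ζ ∧
    ∀ z : ℝ, charFn μ z = Complex.exp (Complex.I * γ * z + ∫ x, gKer c x z ∂ζ)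

/-- The Lévy–Khintchine integral ∫ (e^{izx} - 1 - izc(x)) dν. -/
def lkInt (c : ℝ → ℝ) (ν : Measure ℝ) (z : ℝ) : ℂ :=
  ∫ x, (Complex.exp (Complex.I * z * x) - 1 - Complex.I * z * c x) ∂ν

/-- μ has characteristic triplet (a, ν, γ) w.r.t. c, where the quasi-Lévy measure ν
is given by its Jordan decomposition ν = νp - νm. -/
def HasTriplet (c : ℝ → ℝ) (μ : Measure ℝ) (a : ℝ) (νp νm : Measure ℝ) (γ : ℝ) : Prop :=
  Measure.MutuallySingular νp νm ∧ νp {0} = 0 ∧ νm {0} = 0 ∧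
  (∫⁻ x, ENNReal.ofReal (min 1 (x^2)) ∂(νp + νm)) < ⊤ ∧
  ∀ z : ℝ, charFn μ z =
    Complex.exp (Complex.I * γ * z - a * z^2 / 2 + lkInt c νp z - lkInt c νm z)


/-- `f` is the sum of an absolutely convergent trigonometric series whose coefficients have
`ℓ¹`-norm at most `C`. -/
def HasWienerBound (f : ℝ → ℂ) (C : ℝ) : Prop :=
  ∃ a : ℤ → ℂ, Summable (fun n => ‖a n‖) ∧ ∑' n, ‖a n‖ ≤ C ∧
    ∀ z : ℝ, HasSum (fun n => a n * exp (I * n * z)) (f z)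

lemma norm_exp_I_int_mul (n : ℤ) (z : ℝ) : ‖exp (I * n * z)‖ = 1 := by
  have : I * n * z = ((n * z : ℝ) : ℂ) * I := by push_cast; ring
  rw [this, norm_exp_ofReal_mul_I]

lemma HasWienerBound.of_hasSum {ι : Type*} (a : ι → ℂ) (n : ι → ℤ) {f : ℝ → ℂ} {C : ℝ}
    (ha : Summable (fun i => ‖a i‖)) (hC : ∑' i, ‖a i‖ ≤ C)
    (hf : ∀ z : ℝ, HasSum (fun i => a i * exp (I * n i * z)) (f z)) :
    HasWienerBound f C := by
  have hσ : Summable (fun x : (Σ k : ℤ, {i // n i = k}) => ‖a x.2‖) :=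
    (Equiv.sigmaFiberEquiv n).summable_iff.2 ha
  have hle (k : ℤ) : ‖∑' i : {i // n i = k}, a i‖ ≤ ∑' i : {i // n i = k}, ‖a i‖ :=
    norm_tsum_le_tsum_norm (hσ.sigma_factor k)
  have hsum : Summable fun k : ℤ => ‖∑' i : {i // n i = k}, a i‖ :=
    Summable.of_nonneg_of_le (fun _ => norm_nonneg _) hle hσ.sigma
  refine ⟨fun k => ∑' i : {i // n i = k}, a i, hsum, ?_, fun z => ?_⟩
  · refine (hsum.tsum_le_tsum hle hσ.sigma).trans ?_
    rw [← hσ.tsum_sigma]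
    exact ((Equiv.sigmaFiberEquiv n).tsum_eq (fun i => ‖a i‖)).trans_le hC
  · have h := (Equiv.sigmaFiberEquiv n).hasSum_iff.2 (hf z)
    refine h.sigma fun k => ?_
    have h1 : Summable fun i : {i // n i = k} => a i := (hσ.sigma_factor k).of_norm
    have h2 (i : {i // n i = k}) : a i * exp (I * n i * z) = a i * exp (I * k * z) := by
      rw [i.2]
    exact (h1.hasSum.mul_right (exp (I * k * z))).congr_fun h2

lemma HasWienerBound.mono {f : ℝ → ℂ} {C D : ℝ} (h : HasWienerBound f C) (hCD : C ≤ D) :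
    HasWienerBound f D := by
  obtain ⟨a, h1, h2, h3⟩ := h
  exact ⟨a, h1, h2.trans hCD, h3⟩

lemma HasWienerBound.nonneg {f : ℝ → ℂ} {C : ℝ} (h : HasWienerBound f C) : 0 ≤ C := by
  obtain ⟨a, h1, h2, h3⟩ := h
  exact (tsum_nonneg fun _ => norm_nonneg _).trans h2

lemma HasWienerBound.const (c : ℂ) : HasWienerBound (fun _ => c) ‖c‖ := by
  refine .of_hasSum (ι := Unit) (fun _ => c) (fun _ => 0) (hasSum_fintype _).summable
    (by simp) fun z => ?_
  simp

lemma HasWienerBound.mul {f g : ℝ → ℂ} {C D : ℝ} (hf : HasWienerBound f C)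
    (hg : HasWienerBound g D) : HasWienerBound (fun z => f z * g z) (C * D) := by
  have hC := hf.nonneg
  obtain ⟨a, a1, a2, a3⟩ := hf
  obtain ⟨b, b1, b2, b3⟩ := hg
  have hs : Summable fun p : ℤ × ℤ => ‖a p.1 * b p.2‖ := a1.mul_norm b1
  refine .of_hasSum (fun p : ℤ × ℤ => a p.1 * b p.2) (fun p => p.1 + p.2) hs ?_ fun z => ?_
  · calc _ = ∑' p : ℤ × ℤ, ‖a p.1‖ * ‖b p.2‖ := by simp
      _ = (∑' n, ‖a n‖) * ∑' n, ‖b n‖ := (a1.tsum_mul_tsum b1 (by simpa using hs)).symm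
      _ ≤ C * D := mul_le_mul a2 b2 (tsum_nonneg fun _ => norm_nonneg _) hC
  · have : (fun p : ℤ × ℤ => a p.1 * b p.2 * exp (I * (p.1 + p.2 : ℤ) * z)) =
        fun p : ℤ × ℤ => (a p.1 * exp (I * p.1 * z)) * (b p.2 * exp (I * p.2 * z)) := by
      ext p
      rw [Int.cast_add, mul_add, add_mul, exp_add]
      ring
    have h2 : Summable fun p : ℤ × ℤ =>
        (a p.1 * exp (I * p.1 * z)) * (b p.2 * exp (I * p.2 * z)) :=
      .of_norm (by simpa [norm_exp_I_int_mul] using hs)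
    rw [this]
    have h3 := h2.hasSum
    rwa [← ((a3 z).mul_eq (b3 z) h3)] at h3

lemma HasWienerBound.pow {f : ℝ → ℂ} {C : ℝ} (hf : HasWienerBound f C) (j : ℕ) :
    HasWienerBound (fun z => f z ^ j) (C ^ j) := by
  induction j with
  | zero => simpa using HasWienerBound.const 1
  | succ j ih => simpa only [pow_succ] using ih.mul hf

lemma HasWienerBound.hasSum {f : ℕ → ℝ → ℂ} {C : ℕ → ℝ} (hf : ∀ j, HasWienerBound (f j) (C j))
    (hC : Summable C) {F : ℝ → ℂ} (hF : ∀ z, HasSum (fun j => f j z) (F z)) :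
    HasWienerBound F (∑' j, C j) := by
  choose a a1 a2 a3 using hf
  have hs1 : Summable fun j => ∑' n, ‖a j n‖ :=
    Summable.of_nonneg_of_le (fun _ => tsum_nonneg fun _ => norm_nonneg _) a2 hC
  have hs : Summable fun p : (Σ _ : ℕ, ℤ) => ‖a p.1 p.2‖ :=
    (summable_sigma_of_nonneg fun _ => norm_nonneg _).2 ⟨a1, hs1⟩
  refine .of_hasSum (fun p : (Σ _ : ℕ, ℤ) => a p.1 p.2) (fun p => p.2) hs ?_ fun z => ?_
  · rw [hs.tsum_sigma]
    exact hs1.tsum_le_tsum a2 hC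
  · have h : Summable fun p : (Σ _ : ℕ, ℤ) => a p.1 p.2 * exp (I * p.2 * z) :=
      Summable.of_norm (by simpa [norm_exp_I_int_mul] using hs)
    have h2 := h.hasSum.sigma fun j => a3 j z
    rw [(hF z).unique h2]
    exact h.hasSum

lemma HasWienerBound.add {f g : ℝ → ℂ} {C D : ℝ} (hf : HasWienerBound f C)
    (hg : HasWienerBound g D) : HasWienerBound (fun z => f z + g z) (C + D) := by
  obtain ⟨a, a1, a2, a3⟩ := hf
  obtain ⟨b, b1, b2, b3⟩ := hg
  have h : Summable fun n => ‖a n + b n‖ :=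
    Summable.of_nonneg_of_le (fun _ => norm_nonneg _) (fun _ => norm_add_le _ _) (a1.add b1)
  refine ⟨fun n => a n + b n, h, ?_, fun z => ?_⟩
  · refine (h.tsum_le_tsum (fun _ => norm_add_le _ _) (a1.add b1)).trans ?_
    rw [a1.tsum_add b1]
    exact add_le_add a2 b2
  · simpa only [add_mul] using (a3 z).add (b3 z)

lemma hasDerivAt_exp_I_int_mul (n : ℤ) (x : ℝ) :
    HasDerivAt (fun x : ℝ => exp (I * n * x)) (I * n * exp (I * n * x)) x := by
  have h := ((hasDerivAt_id (x : ℂ)).const_mul (I * n)).cexp.comp_ofReal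
  simpa [mul_comm] using h

lemma exp_I_int_mul_two_pi (n : ℤ) : exp (I * n * (2 * Real.pi : ℝ)) = 1 := by
  rw [exp_eq_one_iff]
  exact ⟨n, by push_cast; ring⟩

lemma integral_exp_mul_deriv {f f' : ℝ → ℂ} (hper : f (2 * Real.pi) = f 0)
    (hf : ∀ x, HasDerivAt f (f' x) x) (hf' : Continuous f') (n : ℤ) :
    ∫ x in (0 : ℝ)..2 * Real.pi, exp (I * n * x) * f' x =
      -(I * n) * ∫ x in (0 : ℝ)..2 * Real.pi, exp (I * n * x) * f x := by
  rw [intervalIntegral.integral_mul_deriv_eq_deriv_mul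
    (fun x _ => hasDerivAt_exp_I_int_mul n x) (fun x _ => hf x)
    (Continuous.intervalIntegrable (by fun_prop) _ _) (hf'.intervalIntegrable _ _),
    exp_I_int_mul_two_pi, hper]
  simp [mul_assoc]

lemma norm_integral_exp_mul_le {f f' f'' : ℝ → ℂ} (hper : f (2 * Real.pi) = f 0)
    (hper' : f' (2 * Real.pi) = f' 0)
    (hf : ∀ x, HasDerivAt f (f' x) x) (hf' : ∀ x, HasDerivAt f' (f'' x) x)
    (hf'' : Continuous f'') {B : ℝ} (hB : ∀ x, ‖f'' x‖ ≤ B) {n : ℤ} (hn : n ≠ 0) :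
    ‖∫ x in (0 : ℝ)..2 * Real.pi, exp (I * n * x) * f x‖ ≤
      2 * Real.pi * (B * (1 / (n : ℝ) ^ 2)) := by
  have hc : Continuous f' := continuous_iff_continuousAt.2 fun x => (hf' x).continuousAt
  have h1 := integral_exp_mul_deriv hper' hf' hf'' n
  rw [integral_exp_mul_deriv hper hf hc n] at h1
  have h2 : ‖∫ x in (0 : ℝ)..2 * Real.pi, exp (I * n * x) * f'' x‖ ≤
      B * |2 * Real.pi - 0| :=
    intervalIntegral.norm_integral_le_of_norm_le_const fun x _ => by
      rw [norm_mul, norm_exp_I_int_mul, one_mul]; exact hB x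
  have hn' : 0 < (n : ℝ) ^ 2 := by positivity
  rw [h1, sub_zero, abs_of_pos Real.two_pi_pos] at h2
  simp only [norm_mul, norm_neg, norm_I, one_mul, norm_intCast] at h2
  rw [← mul_assoc, ← sq, sq_abs] at h2
  rw [mul_one_div, mul_div_assoc', le_div_iff₀ hn']
  linarith

lemma HasWienerBound.of_hasDerivAt {f f' f'' : ℝ → ℂ} (hper : Function.Periodic f (2 * Real.pi))
    (hper' : Function.Periodic f' (2 * Real.pi))
    (hf : ∀ x, HasDerivAt f (f' x) x) (hf' : ∀ x, HasDerivAt f' (f'' x) x)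
    (hf'' : Continuous f'') {A B : ℝ} (hA : ∀ x, ‖f x‖ ≤ A) (hB : ∀ x, ‖f'' x‖ ≤ B) :
    HasWienerBound f (A + B * ∑' n : ℤ, 1 / (n : ℝ) ^ 2) := by
  have : Fact (0 < 2 * Real.pi) := ⟨Real.two_pi_pos⟩
  have hfc : Continuous f := continuous_iff_continuousAt.2 fun x => (hf x).continuousAt
  have hA0 : 0 ≤ A := (norm_nonneg _).trans (hA 0)
  have hB0 : 0 ≤ B := (norm_nonneg _).trans (hB 0)
  let F : C(AddCircle (2 * Real.pi), ℂ) := ⟨hper.lift, continuous_coinduced_dom.2 hfc⟩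
  have hF (x : ℝ) : F (x : AddCircle (2 * Real.pi)) = f x := rfl
  have hfour (n : ℤ) (x : ℝ) :
      fourier n (x : AddCircle (2 * Real.pi)) = exp (I * n * x) := by
    rw [fourier_coe_apply]
    congr 1
    have : (Real.pi : ℂ) ≠ 0 := ofReal_ne_zero.2 Real.pi_ne_zero
    push_cast
    field_simp
  have hcoef (n : ℤ) : ‖fourierCoeff F n‖ =
      1 / (2 * Real.pi) * ‖∫ x in (0 : ℝ)..2 * Real.pi, exp (I * (-n : ℤ) * x) * f x‖ := by
    rw [fourierCoeff_eq_intervalIntegral _ _ 0, norm_smul, zero_add,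
      Real.norm_of_nonneg (by positivity)]
    simp_rw [hfour, hF, smul_eq_mul]
  have hpi := Real.two_pi_pos
  have hsq : Summable fun n : ℤ => 1 / (n : ℝ) ^ 2 := Real.summable_one_div_int_pow.2 one_lt_two
  have hbound (n : ℤ) : ‖fourierCoeff F n‖ ≤ (if n = 0 then A else 0) + B * (1 / (n : ℝ) ^ 2) := by
    rw [hcoef, one_div, inv_mul_le_iff₀ hpi]
    split_ifs with hn
    · subst hn
      have h := intervalIntegral.norm_integral_le_of_norm_le_const (a := 0) (b := 2 * Real.pi)
        (f := fun x : ℝ => exp (I * (-0 : ℤ) * x) * f x) (C := A) fun x _ => by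
          rw [norm_mul, norm_exp_I_int_mul, one_mul]; exact hA x
      rw [sub_zero, abs_of_pos hpi] at h
      simpa [mul_comm] using h
    · have h := norm_integral_exp_mul_le (by simpa using hper 0) (by simpa using hper' 0)
        hf hf' hf'' hB (neg_ne_zero.2 hn)
      simpa using h
  have hs0 := hasSum_ite_eq (0 : ℤ) A
  have hsb := hs0.add (hsq.hasSum.mul_left B)
  have hs : Summable fun n => ‖fourierCoeff F n‖ :=
    Summable.of_nonneg_of_le (fun _ => norm_nonneg _) hbound hsb.summable
  refine ⟨fourierCoeff F, hs, ?_, fun z => ?_⟩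
  · exact hasSum_le hbound hs.hasSum hsb
  · have h := has_pointwise_sum_fourier_series_of_summable (f := F) hs.of_norm z
    simpa only [hfour, hF, smul_eq_mul] using h

lemma HasWienerBound.norm_le {f : ℝ → ℂ} {C : ℝ} (h : HasWienerBound f C) (z : ℝ) :
    ‖f z‖ ≤ C := by
  obtain ⟨a, a1, a2, a3⟩ := h
  rw [← (a3 z).tsum_eq]
  refine (norm_tsum_le_tsum_norm (by simpa [norm_exp_I_int_mul] using a1)).trans ?_
  simpa [norm_exp_I_int_mul] using a2

lemma exists_norm_le_of_periodic {f : ℝ → ℂ} (hper : Function.Periodic f (2 * Real.pi))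
    (hf : Continuous f) : ∃ A : ℝ, 0 < A ∧ ∀ x, ‖f x‖ ≤ A := by
  obtain ⟨A, hA0, hA⟩ :=
    (hper.compact_of_continuous Real.two_pi_pos.ne' hf).isBounded.exists_pos_norm_le
  exact ⟨A, hA0, fun x => hA _ ⟨x, rfl⟩⟩

lemma hasDerivAt_pow_of_logDeriv {u q : ℝ → ℂ} {x : ℝ} (hu : HasDerivAt u (u x * q x) x) (j : ℕ) :
    HasDerivAt (fun x => u x ^ j) (u x ^ j * (j * q x)) x := by
  refine (hu.fun_pow j).congr_deriv ?_
  cases j with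
  | zero => simp
  | succ j => simp only [Nat.add_sub_cancel]; ring

lemma HasWienerBound.pow_of_logDeriv {u q q' : ℝ → ℂ}
    (hup : Function.Periodic u (2 * Real.pi)) (hqp : Function.Periodic q (2 * Real.pi))
    (hu : ∀ x, HasDerivAt u (u x * q x) x) (hq : ∀ x, HasDerivAt q (q' x) x)
    (hq' : Continuous q') {r Q Q' : ℝ} (hr : ∀ x, ‖u x‖ ≤ r) (hQ : ∀ x, ‖q x‖ ≤ Q)
    (hQ' : ∀ x, ‖q' x‖ ≤ Q') (j : ℕ) :
    HasWienerBound (fun x => u x ^ j)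
      (r ^ j + r ^ j * (j ^ 2 * Q ^ 2 + j * Q') * ∑' n : ℤ, 1 / (n : ℝ) ^ 2) := by
  have huc : Continuous u := continuous_iff_continuousAt.2 fun x => (hu x).continuousAt
  have hqc : Continuous q := continuous_iff_continuousAt.2 fun x => (hq x).continuousAt
  have hrj (x : ℝ) : ‖u x ^ j‖ ≤ r ^ j := by
    rw [norm_pow]; exact pow_le_pow_left₀ (norm_nonneg _) (hr x) j
  refine .of_hasDerivAt (f' := fun x => u x ^ j * (j * q x))
    (f'' := fun x => u x ^ j * (j ^ 2 * q x ^ 2 + j * q' x))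
    (fun x => by simp only [hup x]) (fun x => by simp only [hup x, hqp x])
    (fun x => hasDerivAt_pow_of_logDeriv (hu x) j) (fun x => ?_) (by fun_prop) hrj fun x => ?_
  · refine ((hasDerivAt_pow_of_logDeriv (hu x) j).fun_mul
      ((hq x).const_mul (j : ℂ))).congr_deriv ?_
    ring
  · rw [norm_mul]
    refine mul_le_mul (hrj x) ?_ (norm_nonneg _) ((norm_nonneg _).trans (hrj x))
    refine (norm_add_le _ _).trans ?_
    simp only [norm_mul, norm_pow, RCLike.norm_natCast]
    gcongr
    · exact hQ x
    · exact hQ' x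

lemma exists_log_of_logDeriv {P q q' : ℝ → ℂ}
    (hPp : Function.Periodic P (2 * Real.pi)) (hqp : Function.Periodic q (2 * Real.pi))
    (hP : ∀ x, HasDerivAt P (P x * q x) x) (hq : ∀ x, HasDerivAt q (q' x) x)
    (hq' : Continuous q') (hP0 : ∀ x, P x ≠ 0) :
    ∃ (k : ℤ) (g : ℝ → ℂ) (C : ℝ), HasWienerBound g C ∧ ∀ z : ℝ, P z = exp (I * k * z + g z) := by
  have hqc : Continuous q := continuous_iff_continuousAt.2 fun x => (hq x).continuousAt
  let L : ℝ → ℂ := fun z => log (P 0) + ∫ t in (0 : ℝ)..z, q t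
  have hL (z : ℝ) : HasDerivAt L (q z) z :=
    (intervalIntegral.integral_hasDerivAt_right (hqc.intervalIntegrable _ _)
      (hqc.stronglyMeasurableAtFilter _ _) hqc.continuousAt).const_add _
  have hconst {h : ℝ → ℂ} (hh : ∀ x, HasDerivAt h 0 x) (x : ℝ) : h x = h 0 :=
    is_const_of_deriv_eq_zero (fun x => (hh x).differentiableAt) (fun x => (hh x).deriv) x 0
  have hexp (z : ℝ) : P z = exp (L z) := by
    have h1 : P z * exp (-L z) = P 0 * exp (-L 0) :=
      hconst (h := fun z => P z * exp (-L z)) (fun x => by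
        refine ((hP x).fun_mul (hL x).fun_neg.cexp).congr_deriv ?_
        ring) z
    have h2 : L 0 = log (P 0) := by simp [L]
    rw [h2, exp_neg, exp_neg, exp_log (hP0 0), mul_inv_cancel₀ (hP0 0)] at h1
    exact (mul_inv_eq_one₀ (exp_ne_zero _)).1 h1
  have hshift (z : ℝ) : L (z + 2 * Real.pi) - L z = L (2 * Real.pi) - L 0 := by
    have h := hconst (h := fun z => L (z + 2 * Real.pi) - L z) (fun x => by
      refine (((hL (x + 2 * Real.pi)).comp_add_const x (2 * Real.pi)).fun_sub (hL x)).congr_deriv ?_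
      rw [hqp x, sub_self]) z
    simpa using h
  obtain ⟨k, hk⟩ : ∃ k : ℤ, L (2 * Real.pi) - L 0 = k * (2 * Real.pi * I) := by
    rw [← exp_eq_one_iff, exp_sub, ← hexp, ← hexp]
    have := hPp 0
    rw [zero_add] at this
    rw [this, div_self (hP0 0)]
  have hgp : Function.Periodic (fun z : ℝ => L z - I * k * z) (2 * Real.pi) := fun z => by
    have := hshift z
    rw [hk, sub_eq_iff_eq_add] at this
    simp only [this]
    push_cast
    ring
  have hg (x : ℝ) : HasDerivAt (fun z : ℝ => L z - I * k * z) (q x - I * k) x := by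
    refine (hL x).fun_sub ?_
    simpa using ((hasDerivAt_id (x : ℂ)).const_mul (I * k : ℂ)).comp_ofReal
  obtain ⟨A, -, hA⟩ := exists_norm_le_of_periodic hgp
    (continuous_iff_continuousAt.2 fun x => (hg x).continuousAt)
  have hq'p : Function.Periodic q' (2 * Real.pi) := fun x => by
    have h := (hq (x + 2 * Real.pi)).comp_add_const x (2 * Real.pi)
    rw [show (fun x => q (x + 2 * Real.pi)) = q from funext hqp] at h
    exact h.unique (hq x)
  obtain ⟨B, -, hB⟩ := exists_norm_le_of_periodic hq'p hq'
  refine ⟨k, _, _, .of_hasDerivAt hgp (fun x => by simp only [hqp x]) hg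
    (fun x => (hq x).sub_const _) hq' hA hB, fun z => ?_⟩
  rw [hexp z]
  congr 1
  ring

lemma summable_pow_mul_quadratic (Q Q' K : ℝ) : Summable fun j : ℕ =>
    (1 / 2 : ℝ) ^ j * (1 + ((j : ℝ) ^ 2 * Q ^ 2 + j * Q') * K) := by
  have h (k : ℕ) : Summable fun j : ℕ => (j : ℝ) ^ k * (1 / 2 : ℝ) ^ j :=
    summable_pow_mul_geometric_of_norm_lt_one k (by norm_num)
  refine (((h 0).add ((h 2).mul_left (Q ^ 2 * K))).add ((h 1).mul_left (Q' * K))).congr fun j => ?_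
  ring

lemma HasWienerBound.log_one_add {R u q q' : ℝ → ℂ}
    (hup : Function.Periodic u (2 * Real.pi)) (hqp : Function.Periodic q (2 * Real.pi))
    (hu : ∀ x, HasDerivAt u (u x * q x) x) (hq : ∀ x, HasDerivAt q (q' x) x)
    (hq' : Continuous q') {r ε Q Q' : ℝ} (hr : ∀ x, ‖u x‖ ≤ r) (hQ : ∀ x, ‖q x‖ ≤ Q)
    (hQ' : ∀ x, ‖q' x‖ ≤ Q') (hR : HasWienerBound R ε) (hrε : ε * r = 1 / 2) :
    ∃ C, HasWienerBound (fun z => log (1 + R z * u z)) C := by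
  let K := ∑' n : ℤ, 1 / (n : ℝ) ^ 2
  have hK : 0 ≤ K := tsum_nonneg fun _ => by positivity
  have hQ'0 : 0 ≤ Q' := (norm_nonneg _).trans (hQ' 0)
  have hterm (j : ℕ) : HasWienerBound (fun z => (-1) ^ (j + 1) * (R z * u z) ^ j / j)
      ((1 / 2 : ℝ) ^ j * (1 + ((j : ℝ) ^ 2 * Q ^ 2 + j * Q') * K)) := by
    have h := (HasWienerBound.const ((-1) ^ (j + 1) / j)).mul
      ((hR.pow j).mul (.pow_of_logDeriv hup hqp hu hq hq' hr hQ hQ' j))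
    have he : (fun z => (-1) ^ (j + 1) * (R z * u z) ^ j / j) =
        fun z => (-1) ^ (j + 1) / (j : ℂ) * (R z ^ j * u z ^ j) := by
      ext z; rw [mul_pow]; ring
    rw [he]
    refine h.mono ?_
    have h1 : ‖((-1) ^ (j + 1) / j : ℂ)‖ ≤ 1 := by
      simp only [norm_div, norm_pow, norm_neg, norm_one, one_pow, RCLike.norm_natCast, one_div]
      exact Nat.cast_inv_le_one j
    have h2 : ε ^ j * (r ^ j + r ^ j * (j ^ 2 * Q ^ 2 + j * Q') * K) =
        (1 / 2 : ℝ) ^ j * (1 + ((j : ℝ) ^ 2 * Q ^ 2 + j * Q') * K) := by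
      rw [← hrε, mul_pow]; ring
    rw [h2]
    exact mul_le_of_le_one_left (by positivity) h1
  refine ⟨_, .hasSum hterm (summable_pow_mul_quadratic Q Q' K) fun z => ?_⟩
  refine hasSum_taylorSeries_log ?_
  rw [norm_mul]
  calc _ ≤ ε * r := mul_le_mul (hR.norm_le z) (hr z) (norm_nonneg _) hR.nonneg
    _ < 1 := by rw [hrε]; norm_num

lemma periodic_exp_I_int_mul (n : ℤ) (x : ℝ) :
    exp (I * n * (x + 2 * Real.pi : ℝ)) = exp (I * n * x) := by
  rw [ofReal_add, mul_add, exp_add, exp_I_int_mul_two_pi, mul_one]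

/-- The **Wiener–Lévy theorem** for the logarithm: a nowhere vanishing absolutely convergent
trigonometric series is the exponential of such a series, up to a winding factor. -/
theorem wiener_levy_log {p : ℤ → ℂ} {f : ℝ → ℂ} (hp : Summable fun n => ‖p n‖)
    (hf : ∀ z : ℝ, HasSum (fun n => p n * exp (I * n * z)) (f z)) (hf0 : ∀ z, f z ≠ 0) :
    ∃ (k : ℤ) (g : ℝ → ℂ) (C : ℝ), HasWienerBound g C ∧ ∀ z : ℝ, f z = exp (I * k * z + g z) := by
  have hfc : Continuous f := by
    have : f = fun z : ℝ => ∑' n, p n * exp (I * n * z) := funext fun z => (hf z).tsum_eq.symm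
    rw [this]
    refine continuous_tsum (fun n => by fun_prop) hp fun n z => ?_
    rw [norm_mul, norm_exp_I_int_mul, mul_one]
  have hfp : Function.Periodic f (2 * Real.pi) := fun x => by
    refine (hf (x + 2 * Real.pi)).unique ?_
    simpa only [periodic_exp_I_int_mul] using hf x
  obtain ⟨A, hA0, hA⟩ := exists_norm_le_of_periodic (f := fun x => (f x)⁻¹)
    (fun x => by simp only [hfp x]) (hfc.inv₀ hf0)
  have hA' (x : ℝ) : 1 / A ≤ ‖f x‖ := by
    have := hA x
    rw [norm_inv] at this
    rw [one_div]
    exact inv_le_of_inv_le₀ (norm_pos_iff.2 (hf0 x)) this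
  obtain ⟨S, hS⟩ := ((tendsto_tsum_compl_atTop_zero fun n => ‖p n‖).eventually_lt_const
    (show 0 < 1 / (4 * A) by positivity)).exists
  let P (i : ℕ) (x : ℝ) : ℂ := ∑ n ∈ S, p n * (I * n) ^ i * exp (I * n * x)
  have hPd (i : ℕ) (x : ℝ) : HasDerivAt (P i) (P (i + 1) x) x := by
    refine HasDerivAt.fun_sum fun n _ => ?_
    refine ((hasDerivAt_exp_I_int_mul n x).const_mul (p n * (I * n) ^ i)).congr_deriv ?_
    ring
  have hPp (i : ℕ) : Function.Periodic (P i) (2 * Real.pi) := fun x => by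
    simp only [P, periodic_exp_I_int_mul]
  have hPc (i : ℕ) : Continuous (P i) := by fun_prop
  have hR : HasWienerBound (fun z => f z - P 0 z) (1 / (4 * A)) := by
    refine .of_hasSum (ι := {n // n ∉ S}) (fun n => p n) (fun n => n)
      (hp.subtype _) hS.le fun z => ?_
    refine (S.hasSum_compl_iff (f := fun n => p n * exp (I * n * z))).2 ?_
    simpa [P] using hf z
  have hPlow (x : ℝ) : 1 / (2 * A) ≤ ‖P 0 x‖ := by
    have h1 := hR.norm_le x
    have h2 := norm_sub_norm_le (f x) (P 0 x)
    have h3 := hA' x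
    have h4 : 1 / A = 4 * (1 / (4 * A)) := by field_simp
    have h5 : 1 / (2 * A) = 2 * (1 / (4 * A)) := by field_simp; norm_num
    have : 0 < 1 / (4 * A) := by positivity
    linarith
  have hP0 (x : ℝ) : P 0 x ≠ 0 :=
    norm_pos_iff.1 ((show 0 < 1 / (2 * A) by positivity).trans_le (hPlow x))
  let q (x : ℝ) : ℂ := P 1 x / P 0 x
  let q' (x : ℝ) : ℂ := (P 2 x * P 0 x - P 1 x * P 1 x) / P 0 x ^ 2
  have hq (x : ℝ) : HasDerivAt q (q' x) x := (hPd 1 x).fun_div (hPd 0 x) (hP0 x)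
  have hqp : Function.Periodic q (2 * Real.pi) := fun x => by simp only [q, hPp _ x]
  have hq'p : Function.Periodic q' (2 * Real.pi) := fun x => by simp only [q', hPp _ x]
  have hqc : Continuous q := (hPc 1).div (hPc 0) hP0
  have hq'c : Continuous q' := by
    refine Continuous.div ?_ ((hPc 0).pow 2) fun x => pow_ne_zero 2 (hP0 x)
    exact ((hPc 2).mul (hPc 0)).sub ((hPc 1).mul (hPc 1))
  obtain ⟨Q, -, hQ⟩ := exists_norm_le_of_periodic hqp hqc
  obtain ⟨Q', -, hQ'⟩ := exists_norm_le_of_periodic hq'p hq'c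
  have hu (x : ℝ) : HasDerivAt (fun x => (P 0 x)⁻¹) ((P 0 x)⁻¹ * -q x) x := by
    refine ((hPd 0 x).fun_inv (hP0 x)).congr_deriv ?_
    have := hP0 x
    simp only [q]
    field_simp
  obtain ⟨C, hC⟩ := HasWienerBound.log_one_add (q := fun x => -q x) (q' := fun x => -q' x)
    (r := 2 * A) (fun x => by simp only [hPp 0 x]) (fun x => by simp only [hqp x]) hu
    (fun x => (hq x).fun_neg) hq'c.neg (fun x => by
      rw [norm_inv]
      refine inv_le_of_inv_le₀ (by positivity) ?_
      simpa using hPlow x) (fun x => by simpa using hQ x) (fun x => by simpa using hQ' x) hR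
    (by field_simp; norm_num)
  obtain ⟨k, g, D, hg, hPg⟩ := exists_log_of_logDeriv (hPp 0) hqp
    (fun x => by
      refine (hPd 0 x).congr_deriv ?_
      exact (mul_div_cancel₀ _ (hP0 x)).symm) hq hq'c hP0
  refine ⟨k, _, _, hg.add hC, fun z => ?_⟩
  have h1 : 1 + (f z - P 0 z) * (P 0 z)⁻¹ = f z / P 0 z := by
    have := hP0 z
    field_simp
    ring
  rw [← add_assoc, exp_add, ← hPg, h1, exp_log (div_ne_zero (hf0 z) (hP0 z)),
    mul_div_cancel₀ _ (hP0 z)]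

lemma eq_zero_of_exp_eq_one {D : ℝ → ℂ} (hD : Continuous D) (h0 : D 0 = 0)
    (hexp : ∀ z, exp (D z) = 1) (z : ℝ) : D z = 0 := by
  choose n hn using fun z => exp_eq_one_iff.1 (hexp z)
  have hpi := Real.two_pi_pos
  have him (z : ℝ) : (n z : ℝ) = (D z).im / (2 * Real.pi) := by
    rw [hn z, eq_div_iff hpi.ne']
    simp
  have hnc : Continuous n := by
    rw [Int.isClosedEmbedding_coe_real.isInducing.continuous_iff]
    have : ((↑) : ℤ → ℝ) ∘ n = fun z => (D z).im / (2 * Real.pi) := funext him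
    rw [this]
    fun_prop
  have h : n z = n 0 := PreconnectedSpace.constant inferInstance hnc
  have hn0 : n 0 = 0 := by
    have := him 0
    rw [h0] at this
    simpa using this
  rw [hn z, h, hn0]
  simp

lemma conj_exp_I_int_mul (n : ℤ) (z : ℝ) :
    (starRingEnd ℂ) (exp (I * n * (-z : ℝ))) = exp (I * n * z) := by
  rw [← exp_conj]
  simp

lemma exists_real_exponent {p : ℤ → ℝ} {f : ℝ → ℂ} (hp : Summable fun n => ‖p n‖)
    (hf : ∀ z : ℝ, HasSum (fun n => p n * exp (I * n * z)) (f z)) (hf0 : ∀ z, f z ≠ 0)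
    (hf1 : f 0 = 1) :
    ∃ (k : ℤ) (a : ℤ → ℝ), Summable (fun n => ‖a n‖) ∧ ∀ z : ℝ,
      f z = exp (I * k * z + ∑' n, a n * (exp (I * n * z) - 1)) := by
  obtain ⟨k, g, C, ⟨b, b1, -, b3⟩, hfg⟩ :=
    wiener_levy_log (p := fun n => p n) (by simpa using hp) hf hf0
  have hgc : Continuous g := by
    have : g = fun z : ℝ => ∑' n, b n * exp (I * n * z) := funext fun z => (b3 z).tsum_eq.symm
    rw [this]
    refine continuous_tsum (fun n => by fun_prop) b1 fun n z => ?_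
    rw [norm_mul, norm_exp_I_int_mul, mul_one]
  have hg0 : exp (g 0) = 1 := by rw [← hf1, hfg 0]; simp
  let h : ℝ → ℂ := fun z => g z - g 0
  have hfh (z : ℝ) : f z = exp (I * k * z + h z) := by
    rw [hfg, ← add_sub_assoc, exp_sub, hg0, div_one]
  have hsum (z : ℝ) : HasSum (fun n => b n * (exp (I * n * z) - 1)) (h z) := by
    have := (b3 z).sub (b3 0)
    simpa [mul_sub] using this
  have hconj (z : ℝ) : HasSum (fun n => (starRingEnd ℂ) (b n) * (exp (I * n * z) - 1))
      ((starRingEnd ℂ) (h (-z))) := by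
    have := hasSum_conj'.2 (hsum (-z))
    simpa only [map_mul, map_sub, map_one, conj_exp_I_int_mul] using this
  have hfconj (z : ℝ) : f z = (starRingEnd ℂ) (f (-z)) := by
    refine (hf z).unique ?_
    have := hasSum_conj'.2 (hf (-z))
    simpa only [map_mul, conj_ofReal, conj_exp_I_int_mul] using this
  have hD (z : ℝ) : h z - (starRingEnd ℂ) (h (-z)) = 0 := by
    refine eq_zero_of_exp_eq_one (D := fun z => h z - (starRingEnd ℂ) (h (-z)))
      (by fun_prop) (by simp [h]) (fun z => ?_) z
    have h1 := hfconj z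
    rw [hfh, hfh, ← exp_conj, map_add, exp_add, exp_add] at h1
    have h2 : (starRingEnd ℂ) (I * k * (-z : ℝ)) = I * k * z := by simp
    rw [h2] at h1
    rw [exp_sub, mul_left_cancel₀ (exp_ne_zero _) h1, div_self (exp_ne_zero _)]
  refine ⟨k, fun n => (b n).re, ?_, fun z => ?_⟩
  · exact Summable.of_nonneg_of_le (fun _ => norm_nonneg _) (fun n => abs_re_le_norm (b n)) b1
  · have hs := ((hsum z).add (hconj z)).mul_left (1 / 2 : ℂ)
    rw [← sub_eq_zero.1 (hD z)] at hs
    have he : ∀ n, ((b n).re : ℂ) * (exp (I * n * z) - 1) = 1 / 2 * (b n * (exp (I * n * z) - 1) +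
        (starRingEnd ℂ) (b n) * (exp (I * n * z) - 1)) := fun n => by
      rw [re_eq_add_conj]; ring
    rw [hfh, tsum_congr he, hs.tsum_eq]
    congr 2
    ring

/-- The discrete measure on `ℤ ⊆ ℝ` with weight `w n` at `n`. -/
def intMeasure (w : ℤ → ℝ) : Measure ℝ :=
  Measure.sum fun n : ℤ => ENNReal.ofReal (w n) • Measure.dirac (n : ℝ)

lemma intMeasure_apply_eq_zero {w : ℤ → ℝ} {s : Set ℝ} (hs : MeasurableSet s)
    (h : ∀ n : ℤ, (n : ℝ) ∈ s → w n ≤ 0) : intMeasure w s = 0 := by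
  rw [intMeasure, Measure.sum_apply _ hs, ENNReal.tsum_eq_zero]
  intro n
  by_cases hn : (n : ℝ) ∈ s
  · simp [ENNReal.ofReal_eq_zero.2 (h n hn)]
  · simp [Measure.dirac_apply' _ hs, hn]

lemma isFiniteMeasure_intMeasure {w : ℤ → ℝ} (hw : Summable w) (hw0 : ∀ n, 0 ≤ w n) :
    IsFiniteMeasure (intMeasure w) := by
  refine ⟨?_⟩
  rw [intMeasure, Measure.sum_apply _ MeasurableSet.univ]
  simp [← ENNReal.ofReal_tsum_of_nonneg hw0 hw]

lemma hasSum_integral_intMeasure {w : ℤ → ℝ} (hw : Summable w) (hw0 : ∀ n, 0 ≤ w n)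
    {f : ℝ → ℂ} {M : ℝ} (hf : ∀ n : ℤ, w n ≠ 0 → ‖f n‖ ≤ M) :
    HasSum (fun n : ℤ => w n * f n) (∫ x, f x ∂intMeasure w) := by
  have h := hasSum_integral_sum_dirac (c := fun n : ℤ => ENNReal.ofReal (w n))
    (x := fun n : ℤ => (n : ℝ)) (f := f) (fun _ => ENNReal.ofReal_ne_top) (by
      refine Summable.of_nonneg_of_le (fun _ => by positivity) (fun n => ?_) (hw.mul_right M)
      rw [ENNReal.toReal_ofReal (hw0 n)]
      by_cases hn : w n = 0
      · simp [hn]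
      · exact mul_le_mul_of_nonneg_left (hf n hn) (hw0 n))
  refine h.congr_fun fun n => ?_
  rw [ENNReal.toReal_ofReal (hw0 n), real_smul]

lemma gKer_intCast (c : ℝ → ℝ) {n : ℤ} (hn : n ≠ 0) (z : ℝ) :
    gKer c n z = exp (I * n * z) - 1 - I * z * c n := by
  have h1 : (1 : ℝ) ≤ (n : ℝ) ^ 2 := by
    exact_mod_cast Int.one_le_abs (pow_ne_zero 2 hn) |>.trans_eq (abs_of_nonneg (sq_nonneg n))
  rw [gKer, if_neg (Int.cast_ne_zero.2 hn), min_eq_left h1, ofReal_one, div_one]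
  rw [ofReal_intCast, mul_right_comm]

lemma norm_gKer_intCast_le {c : ℝ → ℝ} {M : ℝ} (hM : ∀ x, |c x| ≤ M) {n : ℤ} (hn : n ≠ 0)
    (z : ℝ) : ‖gKer c n z‖ ≤ 1 + 1 + |z| * M := by
  rw [gKer_intCast c hn]
  refine (norm_sub_le _ _).trans (add_le_add ((norm_sub_le _ _).trans ?_) ?_)
  · rw [norm_exp_I_int_mul, norm_one]
  · simp only [norm_mul, norm_I, one_mul, norm_real, Real.norm_eq_abs]
    exact mul_le_mul_of_nonneg_left (hM _) (abs_nonneg z)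

lemma hasSum_integral_gKer {c : ℝ → ℝ} {M : ℝ} (hM : ∀ x, |c x| ≤ M) {w : ℤ → ℝ}
    (hw : Summable w) (hw0 : ∀ n, 0 ≤ w n) (hz : w 0 = 0) (z : ℝ) :
    HasSum (fun n : ℤ => w n * (exp (I * n * z) - 1) - I * z * (w n * c n : ℝ))
      (∫ x, gKer c x z ∂intMeasure w) := by
  have h := hasSum_integral_intMeasure hw hw0 (f := fun x => gKer c x z) (M := 1 + 1 + |z| * M)
    fun n hn => norm_gKer_intCast_le hM (by rintro rfl; exact hn hz) z
  refine h.congr_fun fun n => ?_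
  by_cases hn : n = 0
  · simp [hn, hz]
  · rw [gKer_intCast c hn]
    push_cast
    ring

lemma isQID_of_exponent {c : ℝ → ℝ} (hc : IsRepFn c) {ν : Measure ℝ} {β : ℝ} {a : ℤ → ℝ}
    (ha : Summable fun n => ‖a n‖)
    (hν : ∀ z : ℝ, charFn ν z = exp (I * β * z + ∑' n, a n * (exp (I * n * z) - 1))) :
    IsQID c ν := by
  obtain ⟨-, ⟨M, hM⟩, -⟩ := hc
  have key {w : ℤ → ℝ} (hwa : ∀ n, w n ≤ ‖a n‖) (hw0 : ∀ n, 0 ≤ w n) : Summable w :=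
    Summable.of_nonneg_of_le hw0 hwa ha
  let wp : ℤ → ℝ := fun n => if n = 0 then 0 else max (a n) 0
  let wm : ℤ → ℝ := fun n => if n = 0 then 0 else max (-a n) 0
  have hp0 (n : ℤ) : 0 ≤ wp n := by
    simp only [wp]; split_ifs; exacts [le_rfl, le_max_right _ _]
  have hm0 (n : ℤ) : 0 ≤ wm n := by
    simp only [wm]; split_ifs; exacts [le_rfl, le_max_right _ _]
  have hp : Summable wp := key (fun n => by
    simp only [wp]
    split_ifs
    exacts [norm_nonneg _, max_le (le_abs_self _) (norm_nonneg _)]) hp0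
  have hm : Summable wm := key (fun n => by
    simp only [wm]
    split_ifs
    exacts [norm_nonneg _, max_le (neg_le_abs _) (norm_nonneg _)]) hm0
  have hc' {w : ℤ → ℝ} (hw : Summable w) (hw0 : ∀ n, 0 ≤ w n) :
      Summable fun n : ℤ => w n * c n := by
    refine .of_norm_bounded (hw.mul_right M) fun n => ?_
    rw [norm_mul, Real.norm_of_nonneg (hw0 n)]
    exact mul_le_mul_of_nonneg_left (hM _) (hw0 n)
  refine ⟨β + ((∑' n : ℤ, wp n * c n) - ∑' n : ℤ, wm n * c n), intMeasure wp, intMeasure wm,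
    isFiniteMeasure_intMeasure hp hp0, isFiniteMeasure_intMeasure hm hm0, ?_, fun z => ?_⟩
  · have hs : MeasurableSet (((↑) : ℤ → ℝ) '' {n | 0 < a n}) :=
      ((Set.to_countable _).image _).measurableSet
    refine Measure.MutuallySingular.symm
      ⟨_, hs, intMeasure_apply_eq_zero hs ?_, intMeasure_apply_eq_zero hs.compl ?_⟩
    · rintro n ⟨m, hm, hmn⟩
      obtain rfl : m = n := by exact_mod_cast hmn
      have : max (-a m) 0 = 0 := max_eq_right (neg_nonpos.2 (le_of_lt hm))
      simp [wm, this]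
    · intro n hn
      have : ¬ 0 < a n := fun h => hn ⟨n, h, rfl⟩
      have : max (a n) 0 = 0 := max_eq_right (not_lt.1 this)
      simp [wp, this]
  · have h1 := (hasSum_integral_gKer hM hp hp0 (by simp [wp]) z).sub
      (hasSum_integral_gKer hM hm hm0 (by simp [wm]) z)
    have h2 := (hasSum_ofReal.2 ((hc' hp hp0).hasSum.sub (hc' hm hm0).hasSum)).mul_left (I * z)
    have h3 := (h1.add h2).tsum_eq
    have h4 (n : ℤ) : wp n * (exp (I * n * z) - 1) - I * z * (wp n * c n : ℝ) -
        (wm n * (exp (I * n * z) - 1) - I * z * (wm n * c n : ℝ)) +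
        I * z * ((wp n * c n - wm n * c n : ℝ) : ℂ) = a n * (exp (I * n * z) - 1) := by
      by_cases hn : n = 0
      · simp [hn, wp, wm]
      · have : a n = wp n - wm n := by
          simp only [wp, wm, if_neg hn]
          rcases le_total (a n) 0 with h | h <;> simp [h]
        rw [this]
        push_cast
        ring
    rw [hν z, ← tsum_congr h4]
    refine (congrArg (fun x => exp (I * β * z + x)) h3).trans ?_
    congr 1
    push_cast
    ring

lemma integrable_exp_I_mul (ν : Measure ℝ) [IsFiniteMeasure ν] (z : ℝ) :
    Integrable (fun x : ℝ => exp (I * z * x)) ν := by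
  refine .of_bound (by fun_prop) 1 (.of_forall fun x => ?_)
  have : I * z * x = ((z * x : ℝ) : ℂ) * I := by push_cast; ring
  rw [this, norm_exp_ofReal_mul_I]

/-- A distribution on a shifted integer lattice whose characteristic function has no zeros is
quasi-infinitely divisible. -/
theorem isQID_of_lattice {c : ℝ → ℝ} (hc : IsRepFn c) {ν : Measure ℝ} [IsProbabilityMeasure ν]
    {b : ℝ} (hb : ν (Set.range fun n : ℤ => b + n)ᶜ = 0) (h0 : ∀ z, charFn ν z ≠ 0) :
    IsQID c ν := by
  have hinj : Function.Injective fun n : ℤ => b + (n : ℝ) := fun m n h => by simpa using h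
  have hdisj : Pairwise (Function.onFun Disjoint fun n : ℤ => ({b + (n : ℝ)} : Set ℝ)) :=
    fun m n hmn => Set.disjoint_singleton.2 (hinj.ne hmn)
  have hp : Summable fun n : ℤ => ν.real {b + (n : ℝ)} := by
    have h := hasSum_integral_iUnion (fun n : ℤ => measurableSet_singleton (b + (n : ℝ))) hdisj
      (integrable_const (μ := ν) (1 : ℝ)).integrableOn
    simpa [Measure.real] using h.summable
  have huniv : (⋃ n : ℤ, ({b + (n : ℝ)} : Set ℝ)) =ᵐ[ν] Set.univ := by
    rw [Set.iUnion_singleton_eq_range, ae_eq_univ]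
    exact hb
  have hsum (z : ℝ) : HasSum (fun n : ℤ => (ν.real {b + (n : ℝ)} : ℂ) * exp (I * n * z))
      (exp (-(I * b * z)) * charFn ν z) := by
    have h := hasSum_integral_iUnion (fun n : ℤ => measurableSet_singleton (b + (n : ℝ))) hdisj
      (integrable_exp_I_mul ν z).integrableOn
    rw [setIntegral_congr_set huniv, setIntegral_univ] at h
    refine (h.mul_left (exp (-(I * b * z)))).congr_fun fun n => ?_
    rw [integral_singleton, real_smul, mul_left_comm, ← exp_add]
    congr 2
    push_cast
    ring
  obtain ⟨k, a, ha, hk⟩ := exists_real_exponent hp.norm hsum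
    (fun z => mul_ne_zero (exp_ne_zero _) (h0 z)) (by simp [charFn])
  refine isQID_of_exponent (β := b + k) hc ha fun z => ?_
  have h1 := hk z
  rw [exp_neg, inv_mul_eq_iff_eq_mul₀ (exp_ne_zero _), ← exp_add] at h1
  rw [h1]
  congr 1
  push_cast
  ring

lemma charFn_map_add (μ₁ μ₂ : Measure ℝ) [IsProbabilityMeasure μ₁] [IsProbabilityMeasure μ₂]
    (z : ℝ) : charFn ((μ₁.prod μ₂).map fun p : ℝ × ℝ => p.1 + p.2) z =
      charFn μ₁ z * charFn μ₂ z := by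
  rw [charFn, integral_map (by fun_prop) (by fun_prop)]
  simp only [ofReal_add, mul_add, exp_add]
  exact integral_prod_mul (fun x : ℝ => exp (I * z * x)) (fun x : ℝ => exp (I * z * x))

lemma isQID_snd_of_map_add {c : ℝ → ℝ} (hc : IsRepFn c) {μ₁ μ₂ : Measure ℝ}
    [IsProbabilityMeasure μ₁] [IsProbabilityMeasure μ₂]
    (hqid : IsQID c ((μ₁.prod μ₂).map fun p : ℝ × ℝ => p.1 + p.2))
    (hsupp : (μ₁.prod μ₂).map (fun p : ℝ × ℝ => p.1 + p.2)
      (Set.range ((↑) : ℤ → ℝ))ᶜ = 0) : IsQID c μ₂ := by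
  have hZ : MeasurableSet (Set.range ((↑) : ℤ → ℝ))ᶜ :=
    (Set.countable_range _).measurableSet.compl
  have hadd : Measurable fun p : ℝ × ℝ => p.1 + p.2 := by fun_prop
  rw [Measure.map_apply hadd hZ, Measure.measure_prod_null (hadd hZ)] at hsupp
  obtain ⟨x, hx⟩ := hsupp.exists
  refine isQID_of_lattice (b := -x) hc ?_ fun z hz => ?_
  · refine measure_mono_null (fun y hy => ?_) hx
    rintro ⟨n, hn⟩
    exact hy ⟨n, by simp [hn]⟩
  · obtain ⟨γ, ζp, ζm, -, -, -, h⟩ := hqid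
    have := h z
    rw [charFn_map_add, hz, mul_zero] at this
    exact exp_ne_zero _ this.symm

/-- factors of a quasi-infinitely divisible distribution concentrated
on ℤ are quasi-infinitely divisible. -/
theorem stmt19 (c : ℝ → ℝ) (hc : IsRepFn c) (μ μ₁ μ₂ : Measure ℝ)
    [IsProbabilityMeasure μ] [IsProbabilityMeasure μ₁] [IsProbabilityMeasure μ₂]
    (hconv : μ = (μ₁.prod μ₂).map (fun p : ℝ × ℝ => p.1 + p.2))
    (hqid : IsQID c μ) (hsupp : μ (Set.range ((↑) : ℤ → ℝ))ᶜ = 0) :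
    IsQID c μ₁ ∧ IsQID c μ₂ := by
  subst hconv
  refine ⟨?_, isQID_snd_of_map_add hc hqid hsupp⟩
  have hswap : (μ₁.prod μ₂).map (fun p : ℝ × ℝ => p.1 + p.2) =
      (μ₂.prod μ₁).map fun p : ℝ × ℝ => p.1 + p.2 := by
    rw [← Measure.prod_swap, Measure.map_map (by fun_prop) measurable_swap]
    congr 1
    ext p
    exact add_comm _ _
  rw [hswap] at hqid hsupp
  exact isQID_snd_of_map_add hc hqid hsupp
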